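/- Let k ≥ 1 and let G be a finite tree in which every vertex has degree 1 or 3, with exactly k+1 vertices of degree 1. Let P be a path of G with σ(G) edges, where σ(G) denotes the diameter of G, and suppose σ(G) < k. Then there exists a vertex v of G of degree 3 that does not lie on P and is adjacent to a vertex w lying on P, and moreover this w is adjacent to two vertices of P (i.e. w is an interior vertex of the path P). -/

import Mathlib

namespace SimpleGraph

variable {V : Type*} {G : SimpleGraph V} {x y : V}

/-- A neighbour of the start of a longest path lies on that path. -/
lemma Walk.IsPath.mem_support_of_adj_start {p : G.Walk x y} (hp : p.IsPath)
    (hmax : ∀ (a b : V) (q : G.Walk a b), q.IsPath → q.length ≤ p.length)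
    {v : V} (hadj : G.Adj v x) : v ∈ p.support := by
  by_contra hv
  simpa using hmax _ _ _ (hp.cons hv (h := hadj))

/-- The start of a longest path of positive length in a forest is a leaf. -/
lemma IsAcyclic.degree_start_eq_one_of_longest [Fintype (G.neighborSet x)] (hG : G.IsAcyclic)
    {p : G.Walk x y} (hp : p.IsPath)
    (hmax : ∀ (a b : V) (q : G.Walk a b), q.IsPath → q.length ≤ p.length)
    (hnil : ¬ p.Nil) : G.degree x = 1 :=
  degree_eq_one_iff_existsUnique_adj.mpr ⟨_, p.adj_snd hnil, fun _ hadj ↦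
    hG.eq_snd_of_adj_start hp hadj (hp.mem_support_of_adj_start hmax hadj.symm)⟩

/-- A vertex of a path other than its endpoints has two distinct neighbours along the path. -/
lemma Walk.IsPath.exists_ne_mem_edges {p : G.Walk x y} (hp : p.IsPath) {w : V}
    (hw : w ∈ p.support) (hx : w ≠ x) (hy : w ≠ y) :
    ∃ w₁ w₂ : V, w₁ ≠ w₂ ∧ s(w, w₁) ∈ p.edges ∧ s(w, w₂) ∈ p.edges := by
  obtain ⟨i, rfl, hi⟩ := Walk.mem_support_iff_exists_getVert.mp hw
  have hi0 : i ≠ 0 := by rintro rfl; simp at hx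
  have hil : i ≠ p.length := by rintro rfl; simp at hy
  refine ⟨p.getVert (i - 1), p.getVert (i + 1), fun h ↦ ?_, ?_, ?_⟩
  · have := hp.getVert_injOn (show i - 1 ≤ p.length by lia) (show i + 1 ≤ p.length by lia) h
    lia
  · refine (p.mk_mem_edges_iff_exists).mpr ⟨i - 1, by lia, ?_⟩
    rw [Nat.sub_add_cancel (by lia), Sym2.eq_swap]
  · exact (p.mk_mem_edges_iff_exists).mpr ⟨i, by lia, rfl⟩

/-- In a connected graph, a nonempty set missing some vertex of degree other than one is adjacent
to such a vertex outside of it. -/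
lemma Connected.exists_adj_degree_ne_one [G.LocallyFinite] (hG : G.Connected) {S : Set V}
    (hS : S.Nonempty) {u : V} (huS : u ∉ S) (hu : G.degree u ≠ 1) :
    ∃ v w, v ∉ S ∧ w ∈ S ∧ G.Adj v w ∧ G.degree v ≠ 1 := by
  by_contra! h
  obtain ⟨s, hs⟩ := hS
  suffices ∀ z, G.Reachable s z → z ∈ S ∨ G.degree z = 1 ∧ ∃ w ∈ S, G.Adj z w by
    rcases this u (hG.preconnected s u) with hu' | hu'
    exacts [huS hu', hu hu'.1]
  intro z hz
  rw [reachable_iff_reflTransGen] at hz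
  induction hz with
  | refl => exact .inl hs
  | @tail b c _ hbc ih =>
    by_cases hc : c ∈ S
    · exact .inl hc
    rcases ih with hb | ⟨hb, w, hwS, hbw⟩
    · exact .inr ⟨h c b hc hb hbc.symm, b, hb, hbc.symm⟩
    · exact absurd ((degree_eq_one_iff_existsUnique_adj.mp hb).unique hbw hbc ▸ hwS) hc

/-- A finite tree with all degrees one or three has two more leaves than branch vertices. -/
lemma IsTree.card_degree_one_eq_card_degree_three_add_two [Fintype V] [DecidableRel G.Adj]
    (hG : G.IsTree) (hdeg : ∀ v, G.degree v = 1 ∨ G.degree v = 3) :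
    (Finset.univ.filter fun v ↦ G.degree v = 1).card =
      (Finset.univ.filter fun v ↦ G.degree v = 3).card + 2 := by
  classical
  have hone (v : V) : (if G.degree v = 1 then 1 else 0) + (if G.degree v = 3 then 1 else 0) = 1 := by
    rcases hdeg v with h | h <;> simp [h]
  have hsum (v : V) : G.degree v =
      (if G.degree v = 1 then 1 else 0) + 3 * (if G.degree v = 3 then 1 else 0) := by
    rcases hdeg v with h | h <;> simp [h]
  have hcard := Finset.sum_congr (rfl : (Finset.univ : Finset V) = _) fun v _ ↦ hone v
  have htotal := Finset.sum_congr (rfl : (Finset.univ : Finset V) = _) fun v _ ↦ hsum v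
  rw [Finset.sum_add_distrib, ← Finset.card_filter, ← Finset.card_filter] at hcard
  rw [Finset.sum_add_distrib, ← Finset.mul_sum, ← Finset.card_filter, ← Finset.card_filter,
    G.sum_degrees_eq_twice_card_edges] at htotal
  have := hG.card_edgeFinset
  simp only [Finset.sum_const, Finset.card_univ, smul_eq_mul, mul_one] at hcard
  lia

end SimpleGraph


/-- Let `G` be a finite uni-trivalent tree (every vertex has degree 1 or 3)
with exactly `k+1` vertices of degree 1 (`k ≥ 1`).  Let `p` be a longest path
of `G` (so its length is the diameter `σ(G)`) and suppose `p.length < k`.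
Then there is a degree-3 vertex `v` not on `p` adjacent to a vertex `w` on `p`,
and `w` is an interior vertex of the path: it is adjacent along `p` to two
distinct vertices of `p`. -/
theorem exists_branch_vertex_off_longest_path
    {V : Type*} [Fintype V] [DecidableEq V] (k : ℕ) (hk : 1 ≤ k)
    (G : SimpleGraph V) [DecidableRel G.Adj]
    (htree : G.IsTree)
    (hdeg : ∀ v : V, G.degree v = 1 ∨ G.degree v = 3)
    (hleaves : (Finset.univ.filter (fun v : V => G.degree v = 1)).card = k + 1)
    {x y : V} (p : G.Walk x y) (hp : p.IsPath)
    (hmax : ∀ (a b : V) (q : G.Walk a b), q.IsPath → q.length ≤ p.length)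
    (hlt : p.length < k) :
    ∃ v w : V, G.degree v = 3 ∧ v ∉ p.support ∧ G.Adj v w ∧ w ∈ p.support ∧
      ∃ w₁ w₂ : V, w₁ ≠ w₂ ∧ s(w, w₁) ∈ p.edges ∧ s(w, w₂) ∈ p.edges := by
  have hbranch := htree.card_degree_one_eq_card_degree_three_add_two hdeg
  have hmaxr : ∀ (a b : V) (q : G.Walk a b), q.IsPath → q.length ≤ p.reverse.length := by
    simpa using hmax
  have hnil : ¬ p.Nil := by
    intro hn
    have hpos : 0 < G.degree x := by rcases hdeg x with h | h <;> lia
    obtain ⟨z, hz⟩ := (G.degree_pos_iff_exists_adj x).mp hpos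
    have := hp.mem_support_of_adj_start hmax hz.symm
    rw [SimpleGraph.Walk.nil_iff_support_eq.mp hn, List.mem_singleton] at this
    exact hz.ne' this
  have hxy : x ≠ y := fun h ↦ hnil (hp.nil_iff_eq.mpr h)
  have hdx := htree.isAcyclic.degree_start_eq_one_of_longest hp hmax hnil
  have hdy := htree.isAcyclic.degree_start_eq_one_of_longest hp.reverse hmaxr (by simpa using hnil)
  obtain ⟨u, hu3, hup⟩ : ∃ u, G.degree u = 3 ∧ u ∉ p.support := by
    by_contra! h
    have hsub : Finset.univ.filter (fun v ↦ G.degree v = 3) ⊆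
        (p.support.toFinset.erase x).erase y := by
      intro v hv
      have hv3 : G.degree v = 3 := by simpa using hv
      have hvx : v ≠ x := by rintro rfl; lia
      have hvy : v ≠ y := by rintro rfl; lia
      simpa [hvx, hvy] using h v hv3
    have hcard := Finset.card_le_card hsub
    rw [Finset.card_erase_of_mem (by simp [hxy.symm]), Finset.card_erase_of_mem (by simp),
      List.toFinset_card_of_nodup hp.support_nodup, p.length_support] at hcard
    have := SimpleGraph.Walk.not_nil_iff_lt_length.mp hnil
    lia
  obtain ⟨v, w, hv, hw, hvw, hv1⟩ := htree.connected.exists_adj_degree_ne_one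
    (S := {z | z ∈ p.support}) ⟨x, p.start_mem_support⟩ hup (by lia)
  refine ⟨v, w, (hdeg v).resolve_left hv1, hv, hvw, hw, hp.exists_ne_mem_edges hw ?_ ?_⟩
  · rintro rfl
    exact hv (hp.mem_support_of_adj_start hmax hvw)
  · rintro rfl
    exact hv (by simpa using hp.reverse.mem_support_of_adj_start hmaxr hvw)
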